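/- arXiv:math/0501011 — 3 statements merged into one kernel-verified Lean document; each statement's English description precedes it below -/
import Mathlib

section
/- Every Delzant polygon with exactly three vertices (a Delzant triangle) is the image of a triangle of the form Δ_λ = conv{(0,0), (λ,0), (0,λ)} for some real λ > 0 under an affine transformation x ↦ Ax + b, where A ∈ GL(2,ℤ) (an integer 2×2 matrix with determinant ±1) and b ∈ ℝ². -/
open MeasureTheory

noncomputable section

/-- The real vector in `ℝ²` corresponding to an integer vector in `ℤ²`. -/
def intVec (u : ℤ × ℤ) : ℝ × ℝ := ((u.1 : ℝ), (u.2 : ℝ))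

/-- `RatLenIs w ℓ` : the vector `w` lies on a line of rational slope and has rational
length `ℓ`, i.e. `ℓ > 0` and `w / ℓ` is a primitive vector of `ℤ²` (coprime coordinates). -/
def RatLenIs (w : ℝ × ℝ) (ℓ : ℝ) : Prop :=
  0 < ℓ ∧ ∃ u : ℤ × ℤ, IsCoprime u.1 u.2 ∧ w = ℓ • intVec u

/-- The closed segment `[a, b]`, with `a ≠ b`, is an edge (a one-dimensional face,
i.e. an extreme subset which is a nondegenerate segment) of the convex set `P`. -/
def IsEdge (P : Set (ℝ × ℝ)) (a b : ℝ × ℝ) : Prop :=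
  a ≠ b ∧ IsExtreme ℝ P (segment ℝ a b)

/-- `u ∈ ℤ²` is a direction of an edge of `P` emanating from the vertex `v`. -/
def EdgeDir (P : Set (ℝ × ℝ)) (v : ℝ × ℝ) (u : ℤ × ℤ) : Prop :=
  ∃ w, IsEdge P v w ∧ ∃ ℓ : ℝ, 0 < ℓ ∧ w - v = ℓ • intVec u

/-- The Delzant condition at the vertex `v` of `P`, witnessed by `u₁, u₂` : these are the
primitive integer vectors pointing from `v` along the two edges of `P` incident to `v`,
and they form a `ℤ`-basis of `ℤ²` (their determinant is `±1`). -/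
def DelzantAt (P : Set (ℝ × ℝ)) (v : ℝ × ℝ) (u₁ u₂ : ℤ × ℤ) : Prop :=
  IsCoprime u₁.1 u₁.2 ∧ IsCoprime u₂.1 u₂.2 ∧
  EdgeDir P v u₁ ∧ EdgeDir P v u₂ ∧
  (u₁.1 * u₂.2 - u₁.2 * u₂.1 = 1 ∨ u₁.1 * u₂.2 - u₁.2 * u₂.1 = -1) ∧
  ∀ u : ℤ × ℤ, IsCoprime u.1 u.2 → EdgeDir P v u → u = u₁ ∨ u = u₂

/-- `V` is the (finite) vertex set of a Delzant polygon `P = conv V ⊆ ℝ²`: `P` is a compact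
convex polygon with nonempty interior, its set of vertices (extreme points) is exactly `V`,
and at each vertex the primitive directions of the two incident edges form a `ℤ`-basis of
`ℤ²`; in particular every edge has rational slope. -/
def IsDelzantPolygon (V : Set (ℝ × ℝ)) : Prop :=
  V.Finite ∧ (interior (convexHull ℝ V)).Nonempty ∧
  Set.extremePoints ℝ (convexHull ℝ V) = V ∧
  ∀ v ∈ V, ∃ u₁ u₂ : ℤ × ℤ, DelzantAt (convexHull ℝ V) v u₁ u₂

/-- The new vertex set `(V ∖ {v}) ∪ {v + ε·u₁, v + ε·u₂}` of the `ε`-corner chop at `v`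
of the polygon with vertex set `V`. -/
def chopSet (V : Set (ℝ × ℝ)) (v : ℝ × ℝ) (u₁ u₂ : ℤ × ℤ) (ε : ℝ) : Set (ℝ × ℝ) :=
  (V \ {v}) ∪ {v + ε • intVec u₁, v + ε • intVec u₂}

/-- The polygon with vertex set `W` is an `ε`-corner chop of the Delzant polygon with
vertex set `V` at some vertex `v` whose two incident edges both have rational length
strictly greater than `ε`. -/
def IsCornerChop (V W : Set (ℝ × ℝ)) (ε : ℝ) : Prop :=
  0 < ε ∧ ∃ v ∈ V, ∃ u₁ u₂ : ℤ × ℤ,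
    DelzantAt (convexHull ℝ V) v u₁ u₂ ∧
    (∀ w ℓ, IsEdge (convexHull ℝ V) v w → RatLenIs (w - v) ℓ → ε < ℓ) ∧
    convexHull ℝ W = convexHull ℝ (chopSet V v u₁ u₂ ε)

/-- The vertex set of the standard triangle `Δ = conv {(0,0), (1,0), (0,1)}`. -/
def stdTri : Set (ℝ × ℝ) := {(0, 0), (1, 0), (0, 1)}

/-- Applying an integer `2×2` matrix to a point of `ℝ²`. -/
def applyMat (A : Matrix (Fin 2) (Fin 2) ℤ) (x : ℝ × ℝ) : ℝ × ℝ :=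
  ((A 0 0 : ℝ) * x.1 + (A 0 1 : ℝ) * x.2, (A 1 0 : ℝ) * x.1 + (A 1 1 : ℝ) * x.2)

/-- The other endpoint of an edge is a vertex. -/
lemma IsEdge.right_mem_extremePoints {P : Set (ℝ × ℝ)} {a b : ℝ × ℝ} (h : IsEdge P a b) :
    b ∈ Set.extremePoints ℝ P := by
  refine h.2.extremePoints_subset_extremePoints ?_
  refine mem_extremePoints_iff_left.2 ⟨right_mem_segment ℝ a b, ?_⟩
  intro x hx y hy hxy
  rw [segment_eq_image_lineMap] at hx hy
  rw [openSegment_eq_image_lineMap] at hxy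
  obtain ⟨s, hs, rfl⟩ := hx
  obtain ⟨t, ht, rfl⟩ := hy
  obtain ⟨c, hc, hb⟩ := hxy
  have hab : b - a ≠ 0 := sub_ne_zero.2 h.1.symm
  have key : (1 - (s + c * (t - s))) • (b - a) = 0 := by
    have hb' := sub_eq_zero.2 hb.symm
    simp only [AffineMap.lineMap_apply_module] at hb'
    rw [← hb']
    module
  have h1 : 1 - (s + c * (t - s)) = 0 := (smul_eq_zero.1 key).resolve_right hab
  have hs1 : s = 1 := by
    have := hs.2
    have := ht.2
    have := hc.1
    have := hc.2
    nlinarith [mul_nonneg hc.1.le (sub_nonneg.2 ht.2)]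
  simp [hs1]

/-- The rational length of a vector is unique. -/
lemma RatLenIs.unique {w : ℝ × ℝ} {ℓ m : ℝ} (hℓ : RatLenIs w ℓ) (hm : RatLenIs w m) : ℓ = m := by
  obtain ⟨hℓ0, a, ⟨x, y, hxy⟩, ha⟩ := hℓ
  obtain ⟨hm0, b, ⟨z, t, hzt⟩, hb⟩ := hm
  have h := ha.symm.trans hb
  have h1 : ℓ * a.1 = m * b.1 := by simpa [intVec] using congrArg Prod.fst h
  have h2 : ℓ * a.2 = m * b.2 := by simpa [intVec] using congrArg Prod.snd h
  have hxy' : (x : ℝ) * a.1 + y * a.2 = 1 := by exact_mod_cast hxy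
  have hzt' : (z : ℝ) * b.1 + t * b.2 = 1 := by exact_mod_cast hzt
  have e1 : ℓ = m * (x * b.1 + y * b.2 : ℤ) := by
    push_cast
    linear_combination x * h1 + y * h2 - ℓ * hxy'
  have e2 : m = ℓ * (z * a.1 + t * a.2 : ℤ) := by
    push_cast
    linear_combination -z * h1 - t * h2 - m * hzt'
  generalize x * b.1 + y * b.2 = k at e1
  generalize z * a.1 + t * a.2 = l at e2
  have hk : 0 < k := by
    have : (0 : ℝ) < k := pos_of_mul_pos_right (e1 ▸ hℓ0) hm0.le
    exact_mod_cast this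
  have hl : 0 < l := by
    have : (0 : ℝ) < l := pos_of_mul_pos_right (e2 ▸ hm0) hℓ0.le
    exact_mod_cast this
  have hk1 : (1 : ℝ) ≤ k := by exact_mod_cast hk
  have hl1 : (1 : ℝ) ≤ l := by exact_mod_cast hl
  nlinarith

lemma RatLenIs.neg {w : ℝ × ℝ} {ℓ : ℝ} (h : RatLenIs w ℓ) : RatLenIs (-w) ℓ := by
  obtain ⟨h0, u, hu, rfl⟩ := h
  exact ⟨h0, -u, hu.neg_neg, by ext <;> simp [intVec]⟩

/-- The two sides of a Delzant triangle at a vertex are positive multiples of the elements of a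
basis of the lattice `ℤ²`. -/
lemma IsDelzantPolygon.exists_basis_of_triangle {p q r : ℝ × ℝ}
    (hV : IsDelzantPolygon {p, q, r}) :
    ∃ u v : ℤ × ℤ, ∃ ℓ m : ℝ, IsCoprime u.1 u.2 ∧ IsCoprime v.1 v.2 ∧ 0 < ℓ ∧ 0 < m ∧
      q - p = ℓ • intVec u ∧ r - p = m • intVec v ∧
      (u.1 * v.2 - u.2 * v.1 = 1 ∨ u.1 * v.2 - u.2 * v.1 = -1) := by
  obtain ⟨-, -, hext, hD⟩ := hV
  obtain ⟨u, v, hu, hv, ⟨w, hw, ℓ, hℓ, hwu⟩, ⟨x, hx, m, hm, hxv⟩, hdet, -⟩ := hD p (by simp)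
  have hwV := hw.right_mem_extremePoints
  have hxV := hx.right_mem_extremePoints
  rw [hext] at hwV hxV
  have hwp := hw.1.symm
  have hxp := hx.1.symm
  have hwx : w ≠ x := by
    rintro rfl
    have h := hwu.symm.trans hxv
    have h1 : ℓ * u.1 = m * v.1 := by simpa [intVec] using congrArg Prod.fst h
    have h2 : ℓ * u.2 = m * v.2 := by simpa [intVec] using congrArg Prod.snd h
    have h3 : ℓ * (u.1 * v.2 - u.2 * v.1 : ℤ) = 0 := by
      push_cast
      linear_combination v.2 * h1 - v.1 * h2
    have h4 : u.1 * v.2 - u.2 * v.1 = 0 := by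
      exact_mod_cast (mul_eq_zero.1 h3).resolve_left hℓ.ne'
    omega
  simp only [Set.mem_insert_iff, Set.mem_singleton_iff, hwp, hxp, false_or] at hwV hxV
  rcases hwV with rfl | rfl <;> rcases hxV with rfl | rfl
  · exact absurd rfl hwx
  · exact ⟨u, v, ℓ, m, hu, hv, hℓ, hm, hwu, hxv, hdet⟩
  · refine ⟨v, u, m, ℓ, hv, hu, hm, hℓ, hxv, hwu, ?_⟩
    have : v.1 * u.2 - v.2 * u.1 = -(u.1 * v.2 - u.2 * v.1) := by ring
    omega
  · exact absurd rfl hwx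

/-- The absolute determinant of two sides of a Delzant triangle is the product of their rational
lengths. -/
lemma IsDelzantPolygon.exists_ratLenIs_of_triangle {p q r : ℝ × ℝ}
    (hV : IsDelzantPolygon {p, q, r}) :
    ∃ ℓ m : ℝ, RatLenIs (q - p) ℓ ∧ RatLenIs (r - p) m ∧
      ℓ * m = |(q - p).1 * (r - p).2 - (q - p).2 * (r - p).1| := by
  obtain ⟨u, v, ℓ, m, hu, hv, hℓ, hm, hqu, hrv, hdet⟩ := hV.exists_basis_of_triangle
  refine ⟨ℓ, m, ⟨hℓ, u, hu, hqu⟩, ⟨hm, v, hv, hrv⟩, ?_⟩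
  have habs : |((u.1 * v.2 - u.2 * v.1 : ℤ) : ℝ)| = 1 := by
    rcases hdet with h | h <;> simp only [h] <;> norm_num
  have h : (q - p).1 * (r - p).2 - (q - p).2 * (r - p).1 =
      (ℓ * m) * (u.1 * v.2 - u.2 * v.1 : ℤ) := by
    rw [hqu, hrv]
    simp only [intVec, Prod.smul_mk, smul_eq_mul]
    push_cast
    ring
  rw [h, abs_mul, habs, mul_one, abs_of_pos (mul_pos hℓ hm)]

/-- The map `x ↦ A x + b` as an affine map. -/
def applyMatAffine (A : Matrix (Fin 2) (Fin 2) ℤ) (b : ℝ × ℝ) : (ℝ × ℝ) →ᵃ[ℝ] (ℝ × ℝ) where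
  toFun x := applyMat A x + b
  linear :=
    { toFun := applyMat A
      map_add' := fun x y => by ext <;> simp [applyMat] <;> ring
      map_smul' := fun c x => by ext <;> simp [applyMat] <;> ring }
  map_vadd' x y := by ext <;> simp [applyMat] <;> ring

/-- every Delzant triangle is the image of
`Δ_λ = conv {(0,0), (λ,0), (0,λ)}`, for some `λ > 0`, under a map `x ↦ A x + b` with
`A ∈ GL(2,ℤ)` and `b ∈ ℝ²`. -/
theorem delzant_triangle_classification (V : Set (ℝ × ℝ))
    (hV : IsDelzantPolygon V) (hcard : V.ncard = 3) :
    ∃ lam : ℝ, 0 < lam ∧ ∃ A : Matrix (Fin 2) (Fin 2) ℤ, (A.det = 1 ∨ A.det = -1) ∧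
      ∃ b : ℝ × ℝ, convexHull ℝ V =
        (fun x => applyMat A x + b) ''
          (convexHull ℝ ({(0, 0), (lam, 0), (0, lam)} : Set (ℝ × ℝ))) := by
  obtain ⟨p, q, r, -, -, -, rfl⟩ := Set.ncard_eq_three.1 hcard
  obtain ⟨u, v, ℓ, m, hu, hv, hℓ, hm, hqu, hrv, hdet⟩ := hV.exists_basis_of_triangle
  have hℓm : ℓ = m := by
    have hVq : IsDelzantPolygon {q, p, r} := by rwa [Set.insert_comm]
    have hVr : IsDelzantPolygon {r, p, q} := by
      rwa [Set.insert_comm r p, Set.pair_comm r q]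
    obtain ⟨a, b, ha, hb, hab⟩ := hV.exists_ratLenIs_of_triangle
    obtain ⟨a', c, ha', hc, hac⟩ := hVq.exists_ratLenIs_of_triangle
    obtain ⟨b', c', hb', hc', hbc⟩ := hVr.exists_ratLenIs_of_triangle
    have hℓa : ℓ = a := RatLenIs.unique ⟨hℓ, u, hu, hqu⟩ ha
    have hmb : m = b := RatLenIs.unique ⟨hm, v, hv, hrv⟩ hb
    have haa : a' = a := ha'.unique (by simpa using ha.neg)
    have hbb : b' = b := hb'.unique (by simpa using hb.neg)
    have hcc : c' = c := hc'.unique (by simpa using hc.neg)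
    subst hℓa hmb haa hbb hcc
    have h : a' * c' = b' * c' := by
      rw [hac, hbc, ← abs_neg]
      congr 1
      simp only [Prod.fst_sub, Prod.snd_sub]
      ring
    exact mul_right_cancel₀ hc.1.ne' h
  subst hℓm
  refine ⟨ℓ, hℓ, !![u.1, v.1; u.2, v.2], ?_, p, ?_⟩
  · rw [Matrix.det_fin_two_of]
    rwa [mul_comm v.1 u.2]
  · have himage := (applyMatAffine !![u.1, v.1; u.2, v.2] p).image_convexHull
      ({(0, 0), (ℓ, 0), (0, ℓ)} : Set (ℝ × ℝ))
    refine Eq.trans ?_ himage.symm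
    rw [Set.image_insert_eq, Set.image_pair]
    have h0 : applyMatAffine !![u.1, v.1; u.2, v.2] p (0, 0) = p := by
      ext <;> simp [applyMatAffine, applyMat]
    have h1 : applyMatAffine !![u.1, v.1; u.2, v.2] p (ℓ, 0) = q := by
      rw [← sub_add_cancel q p, hqu]
      ext <;> simp [applyMatAffine, applyMat, intVec, mul_comm]
    have h2 : applyMatAffine !![u.1, v.1; u.2, v.2] p (0, ℓ) = r := by
      rw [← sub_add_cancel r p, hrv]
      ext <;> simp [applyMatAffine, applyMat, intVec, mul_comm]
    rw [h0, h1, h2]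
end
end

section
/- Let P be a Delzant polygon with vertex set V, let v ∈ V, and let u₁, u₂ ∈ ℤ² be the primitive vectors pointing from v along the two edges of P incident to v. Suppose ε > 0 is strictly smaller than the rational lengths of both edges of P incident to v. Then P' = conv((V ∖ {v}) ∪ {v + εu₁, v + εu₂}) is a Delzant polygon whose vertex set is exactly (V ∖ {v}) ∪ {v + εu₁, v + εu₂}; the segment from v + εu₁ to v + εu₂ is an edge of P' of rational length ε; and every edge of P not incident to v is also an edge of P'. -/
open MeasureTheory

noncomputable section

/-- The determinant of two vectors of the plane. -/
def cross (a b : ℝ × ℝ) : ℝ := a.1 * b.2 - a.2 * b.1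

lemma cross_smul_smul (k l : ℝ) (a b : ℝ × ℝ) : cross (k • a) (l • b) = k * l * cross a b := by
  simp only [cross, Prod.smul_fst, Prod.smul_snd, smul_eq_mul]; ring

lemma cross_intVec (u w : ℤ × ℤ) :
    cross (intVec u) (intVec w) = ((u.1 * w.2 - u.2 * w.1 : ℤ) : ℝ) := by
  simp [cross, intVec]

lemma intVec_neg (u : ℤ × ℤ) : intVec (-u) = -intVec u := by
  simp [intVec]

lemma intVec_sub (u w : ℤ × ℤ) : intVec (u - w) = intVec u - intVec w := by
  simp [intVec]

/-- Vectors with vanishing determinant are proportional. -/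
lemma exists_smul_of_cross_eq_zero {a b : ℝ × ℝ} (ha : a ≠ 0) (h : cross a b = 0) :
    ∃ k : ℝ, b = k • a := by
  simp only [cross] at h
  by_cases h1 : a.1 = 0
  · have h2 : a.2 ≠ 0 := fun h2 => ha (Prod.ext h1 h2)
    refine ⟨b.2 / a.2, Prod.ext ?_ ?_⟩
    · simp only [Prod.smul_fst, smul_eq_mul, h1, mul_zero]
      rw [h1] at h
      simpa [h2] using h
    · simp [h2]
  · refine ⟨b.1 / a.1, Prod.ext ?_ ?_⟩
    · simp [h1]
    · simp only [Prod.smul_snd, smul_eq_mul]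
      field_simp
      linarith

/-- Primitive integer vectors on a common ray are equal. -/
lemma eq_of_intVec_eq_smul {u w : ℤ × ℤ} (hu : IsCoprime u.1 u.2) (hw : IsCoprime w.1 w.2)
    {k : ℝ} (hk : 0 < k) (h : intVec u = k • intVec w) : u = w := by
  have hc : u.1 * w.2 = u.2 * w.1 := by
    have h1 : cross (intVec u) (intVec w) = 0 := by
      rw [h]; simp only [cross, Prod.smul_fst, Prod.smul_snd, smul_eq_mul]; ring
    rw [cross_intVec] at h1
    have : u.1 * w.2 - u.2 * w.1 = 0 := by exact_mod_cast h1
    linarith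
  obtain ⟨a, b, hab⟩ := hw
  obtain ⟨c, d, hcd⟩ := hu
  set m := a * u.1 + b * u.2 with hm
  have hu1 : u.1 = m * w.1 := by linear_combination (-u.1) * hab + b * hc
  have hu2 : u.2 = m * w.2 := by linear_combination (-u.2) * hab - a * hc
  have hmu : IsUnit m := by
    refine IsUnit.of_mul_eq_one (c * w.1 + d * w.2) ?_
    linear_combination hcd - c * hu1 - d * hu2
  rcases Int.isUnit_iff.1 hmu with h1 | h1
  · rw [h1] at hu1 hu2
    exact Prod.ext (by simpa using hu1) (by simpa using hu2)
  · rw [h1] at hu1 hu2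
    have h2 := congrArg Prod.fst h
    have h3 := congrArg Prod.snd h
    simp only [intVec, Prod.smul_mk, smul_eq_mul, hu1, hu2] at h2 h3
    push_cast at h2 h3
    have hk1 : (k + 1) * (w.1 : ℝ) = 0 := by linarith
    have hk2 : (k + 1) * (w.2 : ℝ) = 0 := by linarith
    have hk3 : k + 1 ≠ 0 := by linarith
    have h4 : w.1 = 0 := by exact_mod_cast (mul_eq_zero.1 hk1).resolve_left hk3
    have h5 : w.2 = 0 := by exact_mod_cast (mul_eq_zero.1 hk2).resolve_left hk3
    simp [h4, h5] at hab

/-- Coordinates with respect to a `ℤ`-basis of `ℤ²`. -/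
lemma exists_coord {u₁ u₂ : ℤ × ℤ}
    (h : u₁.1 * u₂.2 - u₁.2 * u₂.1 = 1 ∨ u₁.1 * u₂.2 - u₁.2 * u₂.1 = -1) :
    ∃ s t : ℝ × ℝ →ₗ[ℝ] ℝ, (∀ x, x = s x • intVec u₁ + t x • intVec u₂) ∧
      s (intVec u₁) = 1 ∧ s (intVec u₂) = 0 ∧ t (intVec u₁) = 0 ∧ t (intVec u₂) = 1 := by
  set d : ℝ := ((u₁.1 * u₂.2 - u₁.2 * u₂.1 : ℤ) : ℝ) with hd
  have hd2 : d * d = 1 := by rcases h with h | h <;> simp [hd, h]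
  push_cast at hd
  refine ⟨(d * u₂.2) • LinearMap.fst ℝ ℝ ℝ - (d * u₂.1) • LinearMap.snd ℝ ℝ ℝ,
    (d * u₁.1) • LinearMap.snd ℝ ℝ ℝ - (d * u₁.2) • LinearMap.fst ℝ ℝ ℝ, ?_, ?_, ?_, ?_, ?_⟩
  · rintro ⟨x, y⟩
    simp only [intVec, LinearMap.sub_apply, LinearMap.smul_apply, LinearMap.fst_apply,
      LinearMap.snd_apply, smul_eq_mul, Prod.smul_mk, Prod.mk_add_mk, Prod.mk.injEq]
    constructor
    · linear_combination (-x) * hd2 + d * x * hd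
    · linear_combination (-y) * hd2 + d * y * hd
  all_goals
    simp only [intVec, LinearMap.sub_apply, LinearMap.smul_apply, LinearMap.fst_apply,
      LinearMap.snd_apply, smul_eq_mul]
  · linear_combination hd2 - d * hd
  · ring
  · ring
  · linear_combination hd2 - d * hd

lemma IsEdge.symm {P : Set (ℝ × ℝ)} {a b : ℝ × ℝ} (h : IsEdge P a b) : IsEdge P b a :=
  ⟨h.1.symm, segment_symm ℝ a b ▸ h.2⟩

lemma IsEdge.left_mem {P : Set (ℝ × ℝ)} {a b : ℝ × ℝ} (h : IsEdge P a b) : a ∈ P :=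
  h.2.subset (left_mem_segment ℝ a b)

/-- The endpoints of a segment are extreme points of the segment. -/
lemma left_mem_extremePoints_segment (a b : ℝ × ℝ) :
    a ∈ (segment ℝ a b).extremePoints ℝ := by
  rw [mem_extremePoints_iff_left]
  refine ⟨left_mem_segment ℝ a b, ?_⟩
  rintro x hx y hy ⟨α, β, hα, hβ, hαβ, hxy⟩
  rw [segment_eq_image'] at hx hy
  obtain ⟨k, ⟨hk0, hk1⟩, rfl⟩ := hx
  obtain ⟨l, ⟨hl0, hl1⟩, rfl⟩ := hy
  have h1 : (α * k + β * l) • (b - a) = 0 := by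
    have : α • (a + k • (b - a)) + β • (a + l • (b - a)) =
        (α + β) • a + (α * k + β * l) • (b - a) := by module
    simp only [this, hαβ, one_smul] at hxy
    simpa using hxy
  rcases smul_eq_zero.1 h1 with h2 | h2
  · have : k = 0 := by nlinarith [mul_nonneg hβ.le hl0, mul_nonneg hα.le hk0]
    simp [this]
  · simp [h2]

lemma IsEdge.left_mem_extremePoints {P : Set (ℝ × ℝ)} {a b : ℝ × ℝ} (h : IsEdge P a b) :
    a ∈ P.extremePoints ℝ :=
  h.2.extremePoints_subset_extremePoints (left_mem_extremePoints_segment a b)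

/-- A point of `P` on the line spanned by an edge lies on the edge. -/
lemma IsEdge.mem_segment {P : Set (ℝ × ℝ)} {a b : ℝ × ℝ} (h : IsEdge P a b) {k : ℝ}
    (hz : a + k • (b - a) ∈ P) : a + k • (b - a) ∈ segment ℝ a b := by
  rcases lt_or_ge k 0 with hk | hk
  · refine h.2.left_mem_of_mem_openSegment hz h.symm.left_mem (left_mem_segment ℝ a b) ?_
    have h1 : 0 < 1 - k := by linarith
    refine ⟨1 / (1 - k), -k / (1 - k), by positivity, div_pos (by linarith) h1,
      by field_simp; ring, ?_⟩
    ext <;> simp <;> field_simp <;> ring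
  rcases le_or_gt k 1 with hk1 | hk1
  · rw [segment_eq_image']
    exact ⟨k, ⟨hk, hk1⟩, rfl⟩
  · refine h.2.left_mem_of_mem_openSegment hz h.left_mem (right_mem_segment ℝ a b) ?_
    have h1 : 0 < k := by linarith
    refine ⟨1 / k, (k - 1) / k, by positivity, div_pos (by linarith) h1, by field_simp; ring, ?_⟩
    ext <;> simp <;> field_simp <;> ring

/-- The line spanned by an edge of a convex set is a supporting line. -/
lemma IsEdge.cross_mul_nonneg {P : Set (ℝ × ℝ)} (hP : Convex ℝ P) {a b x y : ℝ × ℝ}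
    (h : IsEdge P a b) (hx : x ∈ P) (hy : y ∈ P) :
    0 ≤ cross (b - a) (x - a) * cross (b - a) (y - a) := by
  by_contra! hneg
  set c := cross (b - a) (x - a) with hc
  set d := cross (b - a) (y - a) with hd
  obtain ⟨α, β, hα, hβ, hαβ, h0⟩ : ∃ α β : ℝ, 0 < α ∧ 0 < β ∧ α + β = 1 ∧ α * c + β * d = 0 := by
    rcases mul_neg_iff.1 hneg with ⟨h1, h2⟩ | ⟨h1, h2⟩
    · have h3 : 0 < c - d := by linarith
      exact ⟨-d / (c - d), c / (c - d), div_pos (by linarith) h3, div_pos h1 h3,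
        by field_simp; ring, by field_simp; ring⟩
    · have h3 : 0 < d - c := by linarith
      exact ⟨d / (d - c), -c / (d - c), div_pos h2 h3, div_pos (by linarith) h3,
        by field_simp; ring, by field_simp; ring⟩
  have hz : α • x + β • y ∈ P := hP hx hy hα.le hβ.le hαβ
  have hcz : cross (b - a) (α • x + β • y - a) = 0 := by
    rw [← h0, hc, hd]
    obtain rfl : β = 1 - α := by linarith
    simp only [cross, Prod.fst_sub, Prod.snd_sub, Prod.fst_add, Prod.snd_add, Prod.smul_fst,
      Prod.smul_snd, smul_eq_mul]
    ring
  obtain ⟨k, hk⟩ := exists_smul_of_cross_eq_zero (sub_ne_zero.2 h.1.symm) hcz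
  have hzk : α • x + β • y = a + k • (b - a) := by rw [← hk]; abel
  have hxs : x ∈ segment ℝ a b := by
    refine h.2.left_mem_of_mem_openSegment hx hy (z := α • x + β • y) ?_ ⟨α, β, hα, hβ, hαβ, rfl⟩
    rw [hzk] at hz ⊢
    exact h.mem_segment hz
  rw [segment_eq_image'] at hxs
  obtain ⟨l, -, rfl⟩ := hxs
  have : c = 0 := by
    rw [hc, add_sub_cancel_left]
    simp only [cross, Prod.smul_fst, Prod.smul_snd, smul_eq_mul]
    ring
  simp [this] at hneg

/-- At a common endpoint of two edges of a convex set whose primitive directions form a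
`ℤ`-basis, there are no further edges. -/
lemma DelzantAt.of_edgeDir {P : Set (ℝ × ℝ)} (hP : Convex ℝ P) {a : ℝ × ℝ} {u₁ u₂ : ℤ × ℤ}
    (h1 : IsCoprime u₁.1 u₁.2) (h2 : IsCoprime u₂.1 u₂.2) (e1 : EdgeDir P a u₁)
    (e2 : EdgeDir P a u₂)
    (hdet : u₁.1 * u₂.2 - u₁.2 * u₂.1 = 1 ∨ u₁.1 * u₂.2 - u₁.2 * u₂.1 = -1) :
    DelzantAt P a u₁ u₂ := by
  refine ⟨h1, h2, e1, e2, hdet, ?_⟩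
  rintro u hu ⟨r, hr, n, hn, hrn⟩
  obtain ⟨p, hp, l, hl, hpl⟩ := e1
  obtain ⟨q, hq, m, hm, hqm⟩ := e2
  have hp' := hp.symm.left_mem
  have hq' := hq.symm.left_mem
  have hr' := hr.symm.left_mem
  have k1 := hp.cross_mul_nonneg hP hq' hr'
  have k2 := hq.cross_mul_nonneg hP hp' hr'
  have k3 := hr.cross_mul_nonneg hP hp' hq'
  obtain ⟨s, t, hst, -, -, -, -⟩ := exists_coord hdet
  set A := cross (intVec u₁) (intVec u₂) with hA
  have hA2 : 0 < A * A := by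
    rw [hA, cross_intVec]
    rcases hdet with h | h <;> simp [h]
  set σ := s (intVec u)
  set τ := t (intVec u)
  have hu' : intVec u = σ • intVec u₁ + τ • intVec u₂ := hst _
  rw [hpl, hqm, hrn, cross_smul_smul, cross_smul_smul] at k1 k2 k3
  have c1 : cross (intVec u₁) (intVec u) = τ * A := by
    rw [hu', hA]; simp [cross]; ring
  have c2 : cross (intVec u₂) (intVec u) = -(σ * A) := by
    rw [hu', hA]; simp [cross]; ring
  have c1' : cross (intVec u) (intVec u₁) = -(τ * A) := by
    rw [hu', hA]; simp [cross]; ring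
  have c2' : cross (intVec u) (intVec u₂) = σ * A := by
    rw [hu', hA]; simp [cross]; ring
  have c3 : cross (intVec u₂) (intVec u₁) = -A := by
    rw [hA]; simp [cross]; ring
  rw [c1] at k1
  rw [c2, c3] at k2
  rw [c1', c2'] at k3
  have hτ : 0 ≤ τ := by
    have e : l * m * cross (intVec u₁) (intVec u₂) * (l * n * (τ * A)) =
      (l * m * l * n * (A * A)) * τ := by rw [← hA]; ring
    rw [e] at k1
    exact nonneg_of_mul_nonneg_right k1 (by positivity)
  have hσ : 0 ≤ σ := by
    have e : m * l * -A * (m * n * -(σ * A)) = (m * l * m * n * (A * A)) * σ := by ring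
    rw [e] at k2
    exact nonneg_of_mul_nonneg_right k2 (by positivity)
  have hστ : σ * τ = 0 := by
    have e : n * l * -(τ * A) * (n * m * (σ * A)) = (n * l * n * m * (A * A)) * -(σ * τ) := by
      ring
    rw [e] at k3
    have := nonneg_of_mul_nonneg_right k3 (by positivity)
    exact le_antisymm (by linarith) (mul_nonneg hσ hτ)
  have hu0 : intVec u ≠ 0 := by
    intro h0
    rw [h0, smul_zero, sub_eq_zero] at hrn
    exact hr.1 hrn.symm
  rcases mul_eq_zero.1 hστ with h0 | h0
  · right
    rw [h0, zero_smul, zero_add] at hu'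
    refine eq_of_intVec_eq_smul hu h2 (hτ.lt_of_ne' fun h => hu0 ?_) hu'
    rw [hu', h, zero_smul]
  · left
    rw [h0, zero_smul, add_zero] at hu'
    refine eq_of_intVec_eq_smul hu h1 (hσ.lt_of_ne' fun h => hu0 ?_) hu'
    rw [hu', h, zero_smul]

lemma chopSet_swap (V : Set (ℝ × ℝ)) (v : ℝ × ℝ) (u₁ u₂ : ℤ × ℤ) (ε : ℝ) :
    chopSet V v u₁ u₂ ε = chopSet V v u₂ u₁ ε := by
  rw [chopSet, chopSet, Set.pair_comm]

lemma DelzantAt.swap {P : Set (ℝ × ℝ)} {a : ℝ × ℝ} {u₁ u₂ : ℤ × ℤ} (h : DelzantAt P a u₁ u₂) :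
    DelzantAt P a u₂ u₁ := by
  obtain ⟨h1, h2, h3, h4, h5, h6⟩ := h
  refine ⟨h2, h1, h4, h3, ?_, fun u hu he => (h6 u hu he).symm⟩
  rcases h5 with h | h
  · right; linarith
  · left; linarith

/-- At a Delzant vertex, the polygon has nonnegative second coordinate with respect to the basis of
primitive edge directions. -/
lemma DelzantAt.coord_nonneg {P : Set (ℝ × ℝ)} (hP : Convex ℝ P) {v : ℝ × ℝ} {u₁ u₂ : ℤ × ℤ}
    (h : DelzantAt P v u₁ u₂) {s t : ℝ × ℝ →ₗ[ℝ] ℝ}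
    (hst : ∀ x, x = s x • intVec u₁ + t x • intVec u₂) {x : ℝ × ℝ} (hx : x ∈ P) :
    0 ≤ t (x - v) := by
  obtain ⟨-, -, ⟨p, hp, l, hl, hpl⟩, ⟨q, hq, m, hm, hqm⟩, hdet, -⟩ := h
  have k1 := hp.cross_mul_nonneg hP hq.symm.left_mem hx
  set A := cross (intVec u₁) (intVec u₂) with hA
  have hA2 : 0 < A * A := by
    rw [hA, cross_intVec]
    rcases hdet with h | h <;> simp [h]
  have c1 : cross (l • intVec u₁) (x - v) = l * (t (x - v) * A) := by
    conv_lhs => rw [hst (x - v)]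
    rw [hA]; simp [cross]; ring
  rw [hpl, hqm, cross_smul_smul, c1] at k1
  have e : l * m * cross (intVec u₁) (intVec u₂) * (l * (t (x - v) * A)) =
      (l * m * l * (A * A)) * t (x - v) := by rw [← hA]; ring
  rw [e] at k1
  exact nonneg_of_mul_nonneg_right k1 (by positivity)

section Chop

variable {V : Set (ℝ × ℝ)} {v : ℝ × ℝ} {u₁ u₂ : ℤ × ℤ} {ε : ℝ}

lemma add_smul_mem_segment {w : ℝ × ℝ} {u : ℤ × ℤ} {ℓ : ℝ} (hε : 0 < ε) (hεℓ : ε < ℓ)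
    (hw : w - v = ℓ • intVec u) : v + ε • intVec u ∈ segment ℝ v w := by
  rw [segment_eq_image']
  have hℓ : 0 < ℓ := hε.trans hεℓ
  refine ⟨ε / ℓ, ⟨by positivity, (div_le_one hℓ).2 hεℓ.le⟩, ?_⟩
  simp only [hw, smul_smul]
  rw [div_mul_cancel₀ _ hℓ.ne']

/-- The first new vertex lies in the original polygon. -/
lemma DelzantAt.add_smul_mem {P : Set (ℝ × ℝ)} (hD : DelzantAt P v u₁ u₂) (hε : 0 < ε)
    (hsmall : ∀ w ℓ, IsEdge P v w → RatLenIs (w - v) ℓ → ε < ℓ) : v + ε • intVec u₁ ∈ P := by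
  obtain ⟨hu₁, -, ⟨w, hw, ℓ, hℓ, hwℓ⟩, -⟩ := hD
  exact hw.2.subset (add_smul_mem_segment hε (hsmall w ℓ hw ⟨hℓ, u₁, hu₁, hwℓ⟩) hwℓ)

lemma convexHull_chopSet_subset (hD : DelzantAt (convexHull ℝ V) v u₁ u₂) (hε : 0 < ε)
    (hsmall : ∀ w ℓ, IsEdge (convexHull ℝ V) v w → RatLenIs (w - v) ℓ → ε < ℓ) :
    convexHull ℝ (chopSet V v u₁ u₂ ε) ⊆ convexHull ℝ V := by
  refine convexHull_min ?_ (convex_convexHull ℝ V)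
  rintro x (hx | rfl | rfl)
  · exact subset_convexHull ℝ V hx.1
  · exact hD.add_smul_mem hε hsmall
  · exact hD.swap.add_smul_mem hε hsmall

/-- The chopped polygon lies on the far side of the new edge. -/
lemma le_coord_of_mem_chop (hV : Set.extremePoints ℝ (convexHull ℝ V) = V)
    (hD : DelzantAt (convexHull ℝ V) v u₁ u₂) (hε : 0 < ε)
    (hsmall : ∀ w ℓ, IsEdge (convexHull ℝ V) v w → RatLenIs (w - v) ℓ → ε < ℓ)
    {s t : ℝ × ℝ →ₗ[ℝ] ℝ} (hst : ∀ x, x = s x • intVec u₁ + t x • intVec u₂)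
    (hs₁ : s (intVec u₁) = 1) (hs₂ : s (intVec u₂) = 0) (ht₁ : t (intVec u₁) = 0)
    (ht₂ : t (intVec u₂) = 1) {x : ℝ × ℝ} (hx : x ∈ convexHull ℝ (chopSet V v u₁ u₂ ε)) :
    ε ≤ s (x - v) + t (x - v) := by
  have hconv : Convex ℝ {x | ε + (s + t) v ≤ (s + t) x} := convex_halfSpace_ge (s + t).isLinear _
  have hle : chopSet V v u₁ u₂ ε ⊆ {x | ε + (s + t) v ≤ (s + t) x} := by
    rintro x (⟨hxV, hxv⟩ | rfl | rfl)
    · have hxP := subset_convexHull ℝ V hxV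
      have ht := hD.coord_nonneg (convex_convexHull ℝ V) hst hxP
      have hs := hD.swap.coord_nonneg (convex_convexHull ℝ V) (s := t) (t := s)
        (fun x => by rw [add_comm]; exact hst x) hxP
      obtain ⟨hu₁, hu₂, ⟨p, hp, l, hl, hpl⟩, ⟨q, hq, m, hm, hqm⟩, -, -⟩ := hD
      have hεl := hsmall p l hp ⟨hl, u₁, hu₁, hpl⟩
      have hεm := hsmall q m hq ⟨hm, u₂, hu₂, hqm⟩
      by_contra hlt
      have hlt' : s (x - v) + t (x - v) < ε := by
        simp only [Set.mem_ofPred_eq, LinearMap.add_apply, not_le] at hlt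
        simp only [map_sub]
        linarith
      set σ := s (x - v)
      set τ := t (x - v)
      have hxst : x - v = σ • intVec u₁ + τ • intVec u₂ := hst _
      set c := σ / l + τ / m with hc
      have hc0 : 0 < c := by
        refine lt_of_le_of_ne (by positivity) fun h0 => hxv ?_
        have h1 : 0 ≤ σ / l := by positivity
        have h2 : 0 ≤ τ / m := by positivity
        have h3 : σ / l = 0 := by linarith
        have h4 : τ / m = 0 := by linarith
        have h5 : σ = 0 := by simpa [hl.ne'] using h3
        have h6 : τ = 0 := by simpa [hm.ne'] using h4
        rw [h5, h6, zero_smul, zero_smul, add_zero, sub_eq_zero] at hxst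
        exact hxst
      have hc1 : c < 1 := by
        have h1 : σ / l ≤ σ / ε := div_le_div_of_nonneg_left hs hε hεl.le
        have h2 : τ / m ≤ τ / ε := div_le_div_of_nonneg_left ht hε hεm.le
        have h3 : σ / ε + τ / ε < 1 := by rw [← add_div, div_lt_one hε]; exact hlt'
        linarith
      have hy : (σ / l / c) • p + (τ / m / c) • q ∈ convexHull ℝ V :=
        convex_convexHull ℝ V hp.symm.left_mem hq.symm.left_mem (by positivity) (by positivity)
          (by rw [← add_div, ← hc, div_self hc0.ne'])
      rw [← hV] at hxV
      refine hxv (hxV.2 hp.left_mem hy ⟨1 - c, c, by linarith, hc0, by ring, ?_⟩).symm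
      have h1 : x = v + (σ • intVec u₁ + τ • intVec u₂) := by rw [← hxst]; abel
      have h2 : p = v + l • intVec u₁ := by rw [← hpl]; abel
      have h3 : q = v + m • intVec u₂ := by rw [← hqm]; abel
      rw [h1, h2, h3, smul_add c, smul_smul, smul_smul, mul_div_cancel₀ _ hc0.ne',
        mul_div_cancel₀ _ hc0.ne', smul_add, smul_add, smul_smul, smul_smul,
        div_mul_cancel₀ _ hl.ne', div_mul_cancel₀ _ hm.ne', hc]
      module
    · simp [hs₁, ht₁]
      linarith
    · simp [hs₂, ht₂]
      linarith
  have := convexHull_min hle hconv hx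
  simp only [Set.mem_ofPred_eq, LinearMap.add_apply] at this
  simp only [map_sub]
  linarith

lemma IsEdge.chop (hV : Set.extremePoints ℝ (convexHull ℝ V) = V)
    (hsub : convexHull ℝ (chopSet V v u₁ u₂ ε) ⊆ convexHull ℝ V) {p q : ℝ × ℝ}
    (h : IsEdge (convexHull ℝ V) p q) (hp : p ≠ v) (hq : q ≠ v) :
    IsEdge (convexHull ℝ (chopSet V v u₁ u₂ ε)) p q := by
  refine ⟨h.1, h.2.mono hsub ((convex_convexHull ℝ _).segment_subset ?_ ?_)⟩
  · exact subset_convexHull ℝ _ (Or.inl ⟨hV ▸ h.left_mem_extremePoints, hp⟩)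
  · exact subset_convexHull ℝ _ (Or.inl ⟨hV ▸ h.symm.left_mem_extremePoints, hq⟩)

/-- Chopping the corner `v` truncates the edges incident to `v`. -/
lemma IsEdge.chop_truncate (hV : Set.extremePoints ℝ (convexHull ℝ V) = V)
    (hD : DelzantAt (convexHull ℝ V) v u₁ u₂) (hε : 0 < ε)
    (hsmall : ∀ w ℓ, IsEdge (convexHull ℝ V) v w → RatLenIs (w - v) ℓ → ε < ℓ)
    {w : ℝ × ℝ} {ℓ : ℝ} (hw : IsEdge (convexHull ℝ V) v w) (hwℓ : w - v = ℓ • intVec u₁)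
    (hεℓ : ε < ℓ) :
    IsEdge (convexHull ℝ (chopSet V v u₁ u₂ ε)) (v + ε • intVec u₁) w := by
  obtain ⟨s, t, hst, hs₁, hs₂, ht₁, ht₂⟩ := exists_coord hD.2.2.2.2.1
  have hwv : w = v + ℓ • intVec u₁ := by rw [← hwℓ]; abel
  have ha : v + ε • intVec u₁ ∈ convexHull ℝ (chopSet V v u₁ u₂ ε) :=
    subset_convexHull ℝ _ (Or.inr (Or.inl rfl))
  have hb : w ∈ convexHull ℝ (chopSet V v u₁ u₂ ε) :=
    subset_convexHull ℝ _ (Or.inl ⟨hV ▸ hw.symm.left_mem_extremePoints, hw.1.symm⟩)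
  refine ⟨fun h => ?_, (convex_convexHull ℝ _).segment_subset ha hb, ?_⟩
  · rw [hwv] at h
    have := congrArg s (add_left_cancel h)
    simp only [map_smul, hs₁, smul_eq_mul, mul_one] at this
    linarith
  · intro x hx y hy z hz hzxy
    have hsub := convexHull_chopSet_subset hD hε hsmall
    have hav := add_smul_mem_segment hε hεℓ hwℓ
    have hzvw : z ∈ segment ℝ v w :=
      (convex_segment v w).segment_subset hav (right_mem_segment ℝ v w) hz
    have hxvw := hw.2.left_mem_of_mem_openSegment (hsub hx) (hsub hy) hzvw hzxy
    have hle := le_coord_of_mem_chop hV hD hε hsmall hst hs₁ hs₂ ht₁ ht₂ hx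
    rw [segment_eq_image'] at hxvw
    obtain ⟨k, ⟨hk0, hk1⟩, rfl⟩ := hxvw
    simp only [hwℓ, add_sub_cancel_left, map_smul, hs₁, ht₁, smul_eq_mul, mul_one, mul_zero,
      add_zero] at hle
    have hd : 0 < ℓ - ε := by linarith
    rw [segment_eq_image']
    refine ⟨(k * ℓ - ε) / (ℓ - ε), ⟨div_nonneg (by linarith) hd.le, ?_⟩, ?_⟩
    · rw [div_le_one hd]
      nlinarith
    · simp only [hwv]
      have h1 : v + ℓ • intVec u₁ - (v + ε • intVec u₁) = (ℓ - ε) • intVec u₁ := by module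
      rw [h1, smul_smul, div_mul_cancel₀ _ hd.ne']
      module

/-- The new edge of a corner chop. -/
lemma isEdge_chop (hV : Set.extremePoints ℝ (convexHull ℝ V) = V)
    (hD : DelzantAt (convexHull ℝ V) v u₁ u₂) (hε : 0 < ε)
    (hsmall : ∀ w ℓ, IsEdge (convexHull ℝ V) v w → RatLenIs (w - v) ℓ → ε < ℓ) :
    IsEdge (convexHull ℝ (chopSet V v u₁ u₂ ε)) (v + ε • intVec u₁) (v + ε • intVec u₂) := by
  obtain ⟨s, t, hst, hs₁, hs₂, ht₁, ht₂⟩ := exists_coord hD.2.2.2.2.1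
  have hsub := convexHull_chopSet_subset hD hε hsmall
  refine ⟨fun h => ?_, (convex_convexHull ℝ _).segment_subset
    (subset_convexHull ℝ _ (Or.inr (Or.inl rfl)))
    (subset_convexHull ℝ _ (Or.inr (Or.inr rfl))), ?_⟩
  · have := congrArg s (add_left_cancel h)
    simp only [map_smul, hs₁, hs₂, smul_eq_mul, mul_one, mul_zero] at this
    linarith
  · intro x hx y hy z hz hzxy
    have hxε := le_coord_of_mem_chop hV hD hε hsmall hst hs₁ hs₂ ht₁ ht₂ hx
    have hyε := le_coord_of_mem_chop hV hD hε hsmall hst hs₁ hs₂ ht₁ ht₂ hy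
    have ht0 := hD.coord_nonneg (convex_convexHull ℝ V) hst (hsub hx)
    have hs0 := hD.swap.coord_nonneg (convex_convexHull ℝ V) (s := t) (t := s)
      (fun x => by rw [add_comm]; exact hst x) (hsub hx)
    have hzε : s (z - v) + t (z - v) = ε := by
      rw [segment_eq_image'] at hz
      obtain ⟨k, -, rfl⟩ := hz
      simp only [map_sub, map_add, map_smul, hs₁, hs₂, ht₁, ht₂, smul_eq_mul]
      ring
    have hxeq : s (x - v) + t (x - v) = ε := by
      obtain ⟨α, β, hα, hβ, hαβ, rfl⟩ := hzxy
      obtain rfl : β = 1 - α := by linarith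
      simp only [map_sub, map_add, map_smul, smul_eq_mul] at hzε hxε hyε ⊢
      nlinarith
    rw [segment_eq_image']
    refine ⟨t (x - v) / ε, ⟨by positivity, (div_le_one hε).2 (by linarith)⟩, ?_⟩
    have h1 : v + ε • intVec u₂ - (v + ε • intVec u₁) = ε • (intVec u₂ - intVec u₁) := by module
    have h2 : x = v + (s (x - v) • intVec u₁ + t (x - v) • intVec u₂) := by
      rw [← hst (x - v)]; abel
    simp only [h1, smul_smul]
    rw [div_mul_cancel₀ _ hε.ne']
    conv_rhs => rw [h2]
    have h3 : s (x - v) = ε - t (x - v) := by linarith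
    rw [h3]
    module

/-- A convex set containing a nondegenerate triangle with a side from `v + ε u₁` to `v + ℓ u₁`
and third vertex `v + ε u₂` has nonempty interior. -/
lemma interior_nonempty_of_triangle {C : Set (ℝ × ℝ)} (hC : Convex ℝ C)
    {s t : ℝ × ℝ →ₗ[ℝ] ℝ} (hst : ∀ x, x = s x • intVec u₁ + t x • intVec u₂)
    (hs₁ : s (intVec u₁) = 1) (hs₂ : s (intVec u₂) = 0) (ht₁ : t (intVec u₁) = 0)
    (ht₂ : t (intVec u₂) = 1) {ℓ : ℝ} (hε : 0 < ε) (hεℓ : ε < ℓ) (ha : v + ε • intVec u₁ ∈ C)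
    (hb : v + ε • intVec u₂ ∈ C) (hw : v + ℓ • intVec u₁ ∈ C) : (interior C).Nonempty := by
  set U : Set (ℝ × ℝ) := {x | 0 < t (x - v) ∧ ε < s (x - v) + t (x - v) ∧
    ε * s (x - v) + ℓ * t (x - v) < ε * ℓ} with hU
  have hsc : Continuous s := s.continuous_of_finiteDimensional
  have htc : Continuous t := t.continuous_of_finiteDimensional
  have hUo : IsOpen U := by
    have h1 : IsOpen {x | 0 < t (x - v)} := isOpen_lt (by fun_prop) (by fun_prop)
    have h2 : IsOpen {x | ε < s (x - v) + t (x - v)} := isOpen_lt (by fun_prop) (by fun_prop)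
    have h3 : IsOpen {x | ε * s (x - v) + ℓ * t (x - v) < ε * ℓ} :=
      isOpen_lt (by fun_prop) (by fun_prop)
    exact h1.inter (h2.inter h3)
  have hUC : U ⊆ C := by
    rintro x ⟨h1, h2, h3⟩
    set σ := s (x - v)
    set τ := t (x - v)
    have hd : 0 < ℓ - ε := by linarith
    have hx : x = v + (σ • intVec u₁ + τ • intVec u₂) := by
      rw [← hst (x - v)]; abel
    have hα : 0 ≤ 1 - τ / ε - (σ + τ - ε) / (ℓ - ε) := by
      have : 1 - τ / ε - (σ + τ - ε) / (ℓ - ε) =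
          (ε * ℓ - (ε * σ + ℓ * τ)) / (ε * (ℓ - ε)) := by field_simp; ring
      rw [this]
      exact div_nonneg (by linarith) (by positivity)
    have hmem := hC.sum_mem (t := Finset.univ)
      (w := ![1 - τ / ε - (σ + τ - ε) / (ℓ - ε), τ / ε, (σ + τ - ε) / (ℓ - ε)])
      (z := ![v + ε • intVec u₁, v + ε • intVec u₂, v + ℓ • intVec u₁])
      (by
        intro i _
        fin_cases i
        · exact hα
        · exact (div_pos h1 hε).le
        · exact div_nonneg (by linarith) hd.le)
      (by simp only [Fin.sum_univ_three, Matrix.cons_val]; ring)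
      (by
        intro i _
        fin_cases i
        · exact ha
        · exact hb
        · exact hw)
    convert hmem using 1
    simp only [Fin.sum_univ_three, Matrix.cons_val]
    rw [hx]
    ext <;> simp <;> field_simp <;> ring
  refine Set.Nonempty.mono (interior_maximal hUC hUo)
    ⟨v + (((2 * ε + ℓ) / 3 - ε / 3 : ℝ) • intVec u₁ + (ε / 3) • intVec u₂), ?_⟩
  simp only [hU, Set.mem_ofPred_eq, add_sub_cancel_left, map_add, map_smul, hs₁, hs₂, ht₁, ht₂,
    smul_eq_mul]
  refine ⟨by linarith, by linarith, by nlinarith⟩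

/-- Edge directions at the old vertices survive a corner chop. -/
lemma EdgeDir.chop (hV : Set.extremePoints ℝ (convexHull ℝ V) = V)
    (hD : DelzantAt (convexHull ℝ V) v u₁ u₂) (hε : 0 < ε)
    (hsmall : ∀ w ℓ, IsEdge (convexHull ℝ V) v w → RatLenIs (w - v) ℓ → ε < ℓ)
    {z : ℝ × ℝ} (hz : z ≠ v) {u : ℤ × ℤ} (hu : IsCoprime u.1 u.2)
    (h : EdgeDir (convexHull ℝ V) z u) :
    EdgeDir (convexHull ℝ (chopSet V v u₁ u₂ ε)) z u := by
  obtain ⟨p, hp, l, hl, hpl⟩ := h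
  by_cases hpv : p = v
  · subst hpv
    have hzp : z - p = l • intVec (-u) := by rw [intVec_neg, smul_neg, ← hpl]; abel
    have hu' : IsCoprime (-u).1 (-u).2 := hu.neg_neg
    have hεl := hsmall z l hp.symm ⟨hl, -u, hu', hzp⟩
    suffices h : IsEdge (convexHull ℝ (chopSet V p u₁ u₂ ε)) (p + ε • intVec (-u)) z by
      refine ⟨_, h.symm, l - ε, by linarith, ?_⟩
      have : z = p + l • intVec (-u) := by rw [← hzp]; abel
      rw [this, intVec_neg]
      module
    rcases hD.2.2.2.2.2 (-u) hu' ⟨z, hp.symm, l, hl, hzp⟩ with h | h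
    · rw [h] at hzp ⊢
      exact hp.symm.chop_truncate hV hD hε hsmall hzp hεl
    · rw [h] at hzp ⊢
      rw [chopSet_swap]
      exact hp.symm.chop_truncate hV hD.swap hε hsmall hzp hεl
  · exact ⟨p, hp.chop hV (convexHull_chopSet_subset hD hε hsmall) hz hpv, l, hl, hpl⟩

lemma isCoprime_sub_of_det
    (h : u₁.1 * u₂.2 - u₁.2 * u₂.1 = 1 ∨ u₁.1 * u₂.2 - u₁.2 * u₂.1 = -1) :
    IsCoprime (u₂ - u₁).1 (u₂ - u₁).2 := by
  simp only [Prod.fst_sub, Prod.snd_sub]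
  rcases h with h | h
  · exact ⟨-u₁.2, u₁.1, by linear_combination h⟩
  · exact ⟨u₁.2, -u₁.1, by linear_combination -h⟩

/-- The chopped polygon satisfies the Delzant condition at the first new vertex. -/
lemma DelzantAt.chop (hV : Set.extremePoints ℝ (convexHull ℝ V) = V)
    (hD : DelzantAt (convexHull ℝ V) v u₁ u₂) (hε : 0 < ε)
    (hsmall : ∀ w ℓ, IsEdge (convexHull ℝ V) v w → RatLenIs (w - v) ℓ → ε < ℓ) :
    DelzantAt (convexHull ℝ (chopSet V v u₁ u₂ ε)) (v + ε • intVec u₁) u₁ (u₂ - u₁) := by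
  have hedge := isEdge_chop hV hD hε hsmall
  have hD' := hD
  obtain ⟨hu₁, hu₂, ⟨p, hp, l, hl, hpl⟩, -, hdet, -⟩ := hD
  have hεl := hsmall p l hp ⟨hl, u₁, hu₁, hpl⟩
  refine .of_edgeDir (convex_convexHull ℝ _) hu₁ (isCoprime_sub_of_det hdet)
    ⟨p, hp.chop_truncate hV hD' hε hsmall hpl hεl, l - ε, by linarith, ?_⟩
    ⟨_, hedge, ε, hε, ?_⟩ ?_
  · have : p = v + l • intVec u₁ := by rw [← hpl]; abel
    rw [this]
    module
  · rw [intVec_sub]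
    module
  · simp only [Prod.fst_sub, Prod.snd_sub]
    rcases hdet with h | h
    · left; linear_combination h
    · right; linear_combination h

end Chop

/-- chopping a corner of size `ε` off a Delzant polygon. If `v` is a vertex of
the Delzant polygon `P = conv V`, with primitive incident edge directions `u₁, u₂`, and
`ε > 0` is strictly smaller than the rational lengths of both edges of `P` incident to `v`,
then `P' = conv ((V ∖ {v}) ∪ {v + ε u₁, v + ε u₂})` is a Delzant polygon with vertex set
exactly `(V ∖ {v}) ∪ {v + ε u₁, v + ε u₂}`; the segment from `v + ε u₁` to `v + ε u₂` is
an edge of `P'` of rational length `ε`; and every edge of `P` not incident to `v` is an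
edge of `P'`. -/
theorem delzant_corner_chop (V : Set (ℝ × ℝ)) (hV : IsDelzantPolygon V)
    (v : ℝ × ℝ) (hv : v ∈ V) (u₁ u₂ : ℤ × ℤ)
    (hD : DelzantAt (convexHull ℝ V) v u₁ u₂) (ε : ℝ) (hε : 0 < ε)
    (hsmall : ∀ w ℓ, IsEdge (convexHull ℝ V) v w → RatLenIs (w - v) ℓ → ε < ℓ) :
    IsDelzantPolygon (chopSet V v u₁ u₂ ε) ∧
    Set.extremePoints ℝ (convexHull ℝ (chopSet V v u₁ u₂ ε)) = chopSet V v u₁ u₂ ε ∧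
    IsEdge (convexHull ℝ (chopSet V v u₁ u₂ ε)) (v + ε • intVec u₁) (v + ε • intVec u₂) ∧
    RatLenIs ((v + ε • intVec u₂) - (v + ε • intVec u₁)) ε ∧
    (∀ p q, IsEdge (convexHull ℝ V) p q → p ≠ v → q ≠ v →
      IsEdge (convexHull ℝ (chopSet V v u₁ u₂ ε)) p q) := by
  obtain ⟨hfin, -, hext, hdel⟩ := hV
  have hsub := convexHull_chopSet_subset hD hε hsmall
  have hedge := isEdge_chop hext hD hε hsmall
  have hextr : Set.extremePoints ℝ (convexHull ℝ (chopSet V v u₁ u₂ ε)) =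
      chopSet V v u₁ u₂ ε := by
    refine Set.Subset.antisymm extremePoints_convexHull_subset ?_
    rintro x (hx | rfl | rfl)
    · exact inter_extremePoints_subset_extremePoints_of_subset hsub
        ⟨subset_convexHull ℝ _ (Or.inl hx), hext.symm ▸ hx.1⟩
    · exact hedge.left_mem_extremePoints
    · exact hedge.symm.left_mem_extremePoints
  refine ⟨⟨(hfin.subset Set.sdiff_subset).union (by simp), ?_, hextr, ?_⟩, hextr, hedge, ?_,
    fun p q h hp hq => h.chop hext hsub hp hq⟩
  · obtain ⟨s, t, hst, hs₁, hs₂, ht₁, ht₂⟩ := exists_coord hD.2.2.2.2.1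
    obtain ⟨hu₁, -, ⟨p, hp, l, hl, hpl⟩, -⟩ := hD
    refine interior_nonempty_of_triangle (convex_convexHull ℝ _) hst hs₁ hs₂ ht₁ ht₂ hε
      (hsmall p l hp ⟨hl, u₁, hu₁, hpl⟩) hedge.left_mem hedge.symm.left_mem ?_
    rw [← hpl, add_sub_cancel]
    exact subset_convexHull ℝ _ (Or.inl ⟨hext ▸ hp.symm.left_mem_extremePoints, hp.1.symm⟩)
  · rintro z (⟨hzV, hzv⟩ | rfl | rfl)
    · obtain ⟨a, b, ha, hb, hea, heb, hdet, -⟩ := hdel z hzV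
      exact ⟨a, b, .of_edgeDir (convex_convexHull ℝ _) ha hb (hea.chop hext hD hε hsmall hzv ha)
        (heb.chop hext hD hε hsmall hzv hb) hdet⟩
    · exact ⟨_, _, hD.chop hext hε hsmall⟩
    · rw [chopSet_swap]
      exact ⟨_, _, hD.swap.chop hext hε hsmall⟩
  · refine ⟨hε, u₂ - u₁, isCoprime_sub_of_det hD.2.2.2.2.1, ?_⟩
    rw [intVec_sub]
    module
end
end

section
/- Let P be a Delzant polygon, v a vertex of P with primitive incident edge directions u₁, u₂ ∈ ℤ², and let ε > 0 be strictly smaller than the rational lengths of both edges of P incident to v. Let P' be the ε-corner chop of P at v. Then the Lebesgue areas satisfy vol(P') = vol(P) − ε²/2. -/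
open MeasureTheory

noncomputable section

/-- The linear coordinates with respect to a `ℤ`-basis of `ℤ²`. -/
theorem exists_latticeCoords {u₁ u₂ : ℤ × ℤ}
    (h : u₁.1 * u₂.2 - u₁.2 * u₂.1 = 1 ∨ u₁.1 * u₂.2 - u₁.2 * u₂.1 = -1) :
    ∃ L : (ℝ × ℝ) →ₗ[ℝ] ℝ × ℝ, |LinearMap.det L| = 1 ∧
      (∀ x, x = (L x).1 • intVec u₁ + (L x).2 • intVec u₂) ∧
      L (intVec u₁) = (1, 0) ∧ L (intVec u₂) = (0, 1) := by
  obtain ⟨d, hdabs, hdet⟩ : ∃ d : ℝ, |d| = 1 ∧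
      (u₁.1 : ℝ) * u₂.2 - u₁.2 * u₂.1 = d := by
    rcases h with h | h
    · exact ⟨1, by norm_num, by exact_mod_cast h⟩
    · exact ⟨-1, by norm_num, by exact_mod_cast h⟩
  have hd : d ^ 2 = 1 := by rw [← sq_abs, hdabs, one_pow]
  refine ⟨Matrix.toLin (Module.Basis.finTwoProd ℝ) (Module.Basis.finTwoProd ℝ)
    !![d * u₂.2, -d * u₂.1; -d * u₁.2, d * u₁.1], ?_, ?_, ?_, ?_⟩
  · rw [LinearMap.det_toLin, Matrix.det_fin_two_of]
    have : d * (u₂.2 : ℝ) * (d * u₁.1) - -d * u₂.1 * (-d * u₁.2) = d := by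
      linear_combination d ^ 2 * hdet + d * hd
    rwa [this]
  · intro x
    rw [Matrix.toLin_finTwoProd_apply]
    ext <;> simp only [intVec, Prod.fst_add, Prod.snd_add, Prod.smul_fst, Prod.smul_snd,
      smul_eq_mul]
    · linear_combination -x.1 * d * hdet - x.1 * hd
    · linear_combination -x.2 * d * hdet - x.2 * hd
  · rw [Matrix.toLin_finTwoProd_apply]
    ext <;> simp only [intVec]
    · linear_combination d * hdet + hd
    · ring
  · rw [Matrix.toLin_finTwoProd_apply]
    ext <;> simp only [intVec]
    · ring
    · linear_combination d * hdet + hd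

theorem measurableSet_halfOpen_triangle (ε : ℝ) :
    MeasurableSet {c : ℝ × ℝ | 0 ≤ c.1 ∧ 0 ≤ c.2 ∧ c.1 + c.2 < ε} := by
  measurability

/-- The area of the half-open standard triangle of size `ε`. -/
theorem volume_halfOpen_triangle {ε : ℝ} (hε : 0 < ε) :
    volume {c : ℝ × ℝ | 0 ≤ c.1 ∧ 0 ≤ c.2 ∧ c.1 + c.2 < ε} = ENNReal.ofReal (ε ^ 2 / 2) := by
  rw [Measure.volume_eq_prod, Measure.prod_apply (measurableSet_halfOpen_triangle ε)]
  have hsec (x : ℝ) : volume (Prod.mk x ⁻¹' {c : ℝ × ℝ | 0 ≤ c.1 ∧ 0 ≤ c.2 ∧ c.1 + c.2 < ε})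
      = (Set.Icc 0 ε).indicator (fun x => ENNReal.ofReal (ε - x)) x := by
    by_cases hx : x ∈ Set.Icc 0 ε
    · rw [Set.indicator_of_mem hx, ← sub_zero (ε - x), ← Real.volume_Ico]
      congr 1
      ext y
      simp only [Set.mem_preimage, Set.mem_ofPred_eq, Set.mem_Ico]
      exact ⟨fun h => ⟨h.2.1, by linarith [h.2.2]⟩, fun h => ⟨hx.1, h.1, by linarith [h.2]⟩⟩
    · rw [Set.indicator_of_notMem hx]
      convert measure_empty (μ := (volume : Measure ℝ))
      ext y
      simp only [Set.mem_preimage, Set.mem_ofPred_eq, Set.mem_empty_iff_false, iff_false]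
      exact fun h => hx ⟨h.1, by linarith [h.2.1, h.2.2]⟩
  simp_rw [hsec]
  rw [lintegral_indicator measurableSet_Icc, ← ofReal_integral_eq_lintegral_ofReal]
  · rw [integral_Icc_eq_integral_Ioc, ← intervalIntegral.integral_of_le hε.le]
    congr 1
    rw [intervalIntegral.integral_comp_sub_left (fun x => x) ε, integral_id]
    ring
  · exact (continuous_const.sub continuous_id).integrableOn_Icc
  · filter_upwards [ae_restrict_mem measurableSet_Icc] with x hx
    exact sub_nonneg.2 hx.2

theorem Convex.add_smul_sub_add_smul_sub_mem {E : Type*} [AddCommGroup E] [Module ℝ E]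
    {K : Set E} (hK : Convex ℝ K) {v p q : E} (hv : v ∈ K) (hp : p ∈ K) (hq : q ∈ K)
    {s t : ℝ} (hs : 0 ≤ s) (ht : 0 ≤ t) (hst : s + t ≤ 1) :
    v + s • (p - v) + t • (q - v) ∈ K := by
  rcases (add_nonneg hs ht).eq_or_lt with h0 | h0
  · have hs0 : s = 0 := by linarith
    have ht0 : t = 0 := by linarith
    simpa [hs0, ht0] using hv
  · have hz : (s / (s + t)) • p + (t / (s + t)) • q ∈ K :=
      hK hp hq (by positivity) (by positivity) (by field_simp)
    have h := hK hv hz (a := 1 - (s + t)) (b := s + t) (by linarith) h0.le (by ring)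
    rw [smul_add, smul_smul, smul_smul, mul_div_cancel₀ _ h0.ne', mul_div_cancel₀ _ h0.ne'] at h
    convert h using 1
    module

/-- A convex set lies on one side of each of its edges. -/
theorem nonneg_of_isExtreme_segment {E : Type*} [AddCommGroup E] [Module ℝ E]
    {K : Set E} (hK : Convex ℝ K) {v w₁ w₂ : E}
    (a b : E →ₗ[ℝ] ℝ) {e₁ e₂ : E} (hab : ∀ x, x = a x • e₁ + b x • e₂) (hb : b e₁ = 0)
    {l₁ l₂ : ℝ} (hl₁ : 0 < l₁) (hl₂ : 0 < l₂)
    (hw₁ : w₁ - v = l₁ • e₁) (hw₂ : w₂ - v = l₂ • e₂)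
    (hext : IsExtreme ℝ K (segment ℝ v w₁)) (hw₂K : w₂ ∈ K) {p : E} (hp : p ∈ K) :
    0 ≤ b (p - v) := by
  by_contra! hneg
  have hvK : v ∈ K := hext.1 (left_mem_segment ℝ v w₁)
  have hw₁K : w₁ ∈ K := hext.1 (right_mem_segment ℝ v w₁)
  set A := a (p - v) with hA
  set B := b (p - v) with hB
  obtain ⟨m, hm⟩ : ∃ m, m = |A| / l₁ := ⟨_, rfl⟩
  obtain ⟨n, hn⟩ : ∃ n, n = -B / l₂ := ⟨_, rfl⟩
  have hm0 : 0 ≤ m := by rw [hm]; positivity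
  have hn0 : 0 ≤ n := by rw [hn]; exact div_nonneg (by linarith) hl₂.le
  have hm' : m * l₁ = |A| := by rw [hm]; field_simp
  have hn' : n * l₂ = -B := by rw [hn]; field_simp
  obtain ⟨t, ht⟩ : ∃ t, t = 1 / (2 * (1 + m + n)) := ⟨_, rfl⟩
  have ht0 : 0 < t := by rw [ht]; positivity
  have ht' : 2 * t + 2 * t * m + 2 * t * n = 1 := by
    rw [ht]; field_simp
  have htm : 0 ≤ t * m := by positivity
  have htn : 0 ≤ t * n := by positivity
  have hx₁ := hK.add_smul_sub_add_smul_sub_mem hvK hp hw₁K (s := 2 * t) (t := 2 * (t * m))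
    (by positivity) (by positivity) (by linarith)
  have hx₂ := hK.add_smul_sub_add_smul_sub_mem hvK hw₂K hw₂K (s := 2 * (t * n)) (t := 0)
    (by positivity) le_rfl (by linarith)
  have hpe : p - v = A • e₁ + B • e₂ := hab (p - v)
  have hq : v + (t * A + t * |A|) • e₁ ∈ segment ℝ v w₁ := by
    rw [segment_eq_image']
    refine ⟨(t * A + t * |A|) / l₁, ⟨div_nonneg ?_ hl₁.le, (div_le_one hl₁).2 ?_⟩, ?_⟩
    · have := neg_abs_le A
      nlinarith
    · have := le_abs_self A
      rw [← hm'] at *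
      nlinarith
    · simp only [hw₁, smul_smul]
      congr 2
      field_simp
  have hmid : v + (t * A + t * |A|) • e₁ ∈ openSegment ℝ
      (v + (2 * t) • (p - v) + (2 * (t * m)) • (w₁ - v))
      (v + (2 * (t * n)) • (w₂ - v) + (0 : ℝ) • (w₂ - v)) := by
    refine ⟨1 / 2, 1 / 2, by norm_num, by norm_num, by norm_num, ?_⟩
    rw [hw₁, hw₂, hpe, ← hm']
    have hBn : B = -(n * l₂) := by linarith
    rw [hBn]
    module
  have hmem := hext.2 hx₁ hx₂ hq hmid
  rw [segment_eq_image'] at hmem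
  obtain ⟨θ, -, hθ⟩ := hmem
  have hb' := congrArg (fun x => b (x - v)) hθ
  simp only [hw₁, add_assoc, add_sub_cancel_left, map_add, map_smul, hb, smul_eq_mul,
    mul_zero, add_zero, ← hB] at hb'
  nlinarith

/-- the `ε`-corner chop of a Delzant polygon at a vertex decreases the
Lebesgue area by exactly `ε²/2`, i.e. `vol(P') = vol(P) − ε²/2`. -/
theorem delzant_corner_chop_volume (V : Set (ℝ × ℝ)) (hV : IsDelzantPolygon V)
    (v : ℝ × ℝ) (hv : v ∈ V) (u₁ u₂ : ℤ × ℤ)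
    (hD : DelzantAt (convexHull ℝ V) v u₁ u₂) (ε : ℝ) (hε : 0 < ε)
    (hsmall : ∀ w ℓ, IsEdge (convexHull ℝ V) v w → RatLenIs (w - v) ℓ → ε < ℓ) :
    volume (convexHull ℝ (chopSet V v u₁ u₂ ε)) + ENNReal.ofReal (ε ^ 2 / 2)
      = volume (convexHull ℝ V) := by
  obtain ⟨-, -, hVext, -⟩ := hV
  obtain ⟨hc₁, hc₂, ⟨w₁, he₁, l₁, hl₁, hw₁⟩, ⟨w₂, he₂, l₂, hl₂, hw₂⟩, hdet, -⟩ := hD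
  have hεl₁ : ε < l₁ := hsmall w₁ l₁ he₁ ⟨hl₁, u₁, hc₁, hw₁⟩
  have hεl₂ : ε < l₂ := hsmall w₂ l₂ he₂ ⟨hl₂, u₂, hc₂, hw₂⟩
  obtain ⟨L, hLdet, hL, hL₁, hL₂⟩ := exists_latticeCoords hdet
  set e₁ := intVec u₁
  set e₂ := intVec u₂
  set K := convexHull ℝ V with hKdef
  have hK : Convex ℝ K := convex_convexHull ℝ V
  have hvK : v ∈ K := subset_convexHull ℝ V hv
  have hw₁K : w₁ ∈ K := he₁.2.1 (right_mem_segment ℝ v w₁)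
  have hw₂K : w₂ ∈ K := he₂.2.1 (right_mem_segment ℝ v w₂)
  have ha : ∀ p ∈ K, 0 ≤ (L (p - v)).1 := fun p hp =>
    nonneg_of_isExtreme_segment hK (LinearMap.snd ℝ ℝ ℝ ∘ₗ L) (LinearMap.fst ℝ ℝ ℝ ∘ₗ L)
      (fun x => (hL x).trans (add_comm _ _)) (by simp [hL₂]) hl₂ hl₁ hw₂ hw₁ he₂.2 hw₁K hp
  have hb : ∀ p ∈ K, 0 ≤ (L (p - v)).2 := fun p hp =>
    nonneg_of_isExtreme_segment hK (LinearMap.fst ℝ ℝ ℝ ∘ₗ L) (LinearMap.snd ℝ ℝ ℝ ∘ₗ L)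
      hL (by simp [hL₁]) hl₁ hl₂ hw₁ hw₂ he₁.2 hw₂K hp
  have hcorner {a b : ℝ} (ha : 0 ≤ a) (hb : 0 ≤ b) (hab : a + b ≤ ε) :
      v + a • e₁ + b • e₂ ∈ K := by
    have h := hK.add_smul_sub_add_smul_sub_mem hvK hw₁K hw₂K
      (s := a / l₁) (t := b / l₂) (by positivity) (by positivity) (by
        have h₁ : a / l₁ ≤ a / ε := by gcongr
        have h₂ : b / l₂ ≤ b / ε := by gcongr
        have h₃ : a / ε + b / ε ≤ 1 := by rw [← add_div]; exact (div_le_one hε).2 hab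
        linarith)
    rwa [hw₁, hw₂, smul_smul, smul_smul, div_mul_cancel₀ _ hl₁.ne',
      div_mul_cancel₀ _ hl₂.ne'] at h
  set K' := convexHull ℝ (chopSet V v u₁ u₂ ε)
  have hK' : Convex ℝ K' := convex_convexHull ℝ _
  have hp₁ : v + ε • e₁ ∈ K' := subset_convexHull ℝ _ (Or.inr (Or.inl rfl))
  have hp₂ : v + ε • e₂ ∈ K' := subset_convexHull ℝ _ (Or.inr (Or.inr rfl))
  have hK'K : K' ⊆ K := by
    refine convexHull_min ?_ hK
    rintro x (hx | rfl | rfl)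
    · exact subset_convexHull ℝ V hx.1
    · simpa using hcorner hε.le le_rfl (by simp)
    · simpa using hcorner le_rfl hε.le (by simp)
  have hVfar : ∀ x ∈ V \ {v}, ε ≤ (L (x - v)).1 + (L (x - v)).2 := by
    rintro x ⟨hxV, hxv⟩
    by_contra! hlt
    have hxK : x ∈ K := subset_convexHull ℝ V hxV
    have ha0 := ha x hxK
    have hb0 := hb x hxK
    have hxe := hL (x - v)
    set a := (L (x - v)).1
    set b := (L (x - v)).2
    have hpos : 0 < a + b := by
      rcases (add_nonneg ha0 hb0).lt_or_eq with h | h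
      · exact h
      · exfalso
        apply hxv
        have h₁ : a = 0 := by linarith
        have h₂ : b = 0 := by linarith
        rw [h₁, h₂, zero_smul, zero_smul, add_zero, sub_eq_zero] at hxe
        exact hxe
    have hs : 1 < ε / (a + b) := (one_lt_div hpos).2 hlt
    have hy := hcorner (a := ε / (a + b) * a) (b := ε / (a + b) * b)
      (by positivity) (by positivity) (by rw [← mul_add, div_mul_cancel₀ _ hpos.ne'])
    have hxext : x ∈ Set.extremePoints ℝ K := by rw [hVext]; exact hxV
    refine hxv (hxext.2 hvK hy ?_).symm
    set s := ε / (a + b)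
    refine ⟨1 - 1 / s, 1 / s, ?_, by positivity, by ring, ?_⟩
    · have := (div_lt_one (by linarith)).2 hs
      linarith
    · have : x = v + (a • e₁ + b • e₂) := by rw [← hxe]; abel
      rw [this]
      have hs1 : 1 / s * s = 1 := by field_simp
      calc _ = v + (1 / s * s) • (a • e₁ + b • e₂) := by module
        _ = _ := by rw [hs1, one_smul]
  have hfar : ∀ x ∈ K', ε ≤ (L (x - v)).1 + (L (x - v)).2 := by
    let g : (ℝ × ℝ) →ₗ[ℝ] ℝ := LinearMap.fst ℝ ℝ ℝ ∘ₗ L + LinearMap.snd ℝ ℝ ℝ ∘ₗ L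
    have hg : ∀ x, (L (x - v)).1 + (L (x - v)).2 = g x - g v := fun x => by
      rw [← map_sub]; rfl
    have hsub : K' ⊆ {x | ε + g v ≤ g x} := by
      refine convexHull_min ?_ (convex_halfSpace_ge g.isLinear _)
      rintro x (hx | rfl | rfl)
      · have := hVfar x hx
        rw [hg] at this
        exact (by linarith : ε + g v ≤ g x)
      · have h : g e₁ = 1 := by simp [g, hL₁]
        rw [Set.mem_ofPred_eq, map_add, map_smul, h, smul_eq_mul, mul_one, add_comm]
      · have h : g e₂ = 1 := by simp [g, hL₂]
        rw [Set.mem_ofPred_eq, map_add, map_smul, h, smul_eq_mul, mul_one, add_comm]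
    intro x hx
    rw [hg]
    have : ε + g v ≤ g x := hsub hx
    linarith
  set S : Set (ℝ × ℝ) := {c | 0 ≤ c.1 ∧ 0 ≤ c.2 ∧ c.1 + c.2 < ε}
  set T : Set (ℝ × ℝ) := (fun x => x - v) ⁻¹' (L ⁻¹' S) with hT
  have hTm : MeasurableSet T :=
    ((measurableSet_halfOpen_triangle ε).preimage L.continuous_of_finiteDimensional.measurable).preimage
      (measurable_id.sub_const v)
  have hTvol : volume T = ENNReal.ofReal (ε ^ 2 / 2) := by
    simp_rw [hT, sub_eq_add_neg]
    rw [measure_preimage_add_right, Measure.addHaar_preimage_linearMap, abs_inv, hLdet,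
      inv_one, ENNReal.ofReal_one, one_mul, volume_halfOpen_triangle hε]
    intro h
    simp [h] at hLdet
  have hdisj : Disjoint K' T := by
    rw [Set.disjoint_left]
    intro x hx hxT
    exact absurd (hfar x hx) (not_le.2 hxT.2.2)
  have hTK : T ⊆ K := by
    rintro x ⟨h₁, h₂, h₃⟩
    have := hcorner h₁ h₂ h₃.le
    rwa [add_assoc, ← hL, add_sub_cancel] at this
  have hcover : K ⊆ K' ∪ T := by
    intro x hx
    by_cases hxT : x ∈ T
    · exact Or.inr hxT
    left
    have hxfar : ε ≤ (L (x - v)).1 + (L (x - v)).2 := by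
      by_contra! h
      exact hxT ⟨ha x hx, hb x hx, h⟩
    have hne : (V \ {v}).Nonempty := by
      by_contra! h
      have hVv : V ⊆ {v} := Set.sdiff_eq_empty.1 h
      have hxv : x ∈ ({v} : Set (ℝ × ℝ)) := convexHull_min hVv (convex_singleton v) hx
      rw [Set.mem_singleton_iff.1 hxv] at hxfar
      simp at hxfar
      linarith
    rw [hKdef, ← Set.insert_eq_of_mem hv, ← Set.insert_sdiff_singleton,
      convexHull_insert hne, mem_convexJoin] at hx
    obtain ⟨v', hv', y, hy, hxy⟩ := hx
    rw [Set.mem_singleton_iff.1 hv'] at hxy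
    have hyK' : y ∈ K' := convexHull_mono Set.subset_union_left hy
    have ha0 := ha y (hK'K hyK')
    have hb0 := hb y (hK'K hyK')
    have hye := hL (y - v)
    rw [segment_eq_image'] at hxy
    obtain ⟨θ, ⟨hθ0, hθ1⟩, rfl⟩ := hxy
    simp only [add_sub_cancel_left, map_smul, Prod.smul_fst, Prod.smul_snd, smul_eq_mul]
      at hxfar
    set a := (L (y - v)).1
    set b := (L (y - v)).2
    have hab : 0 < a + b := by
      by_contra! h
      nlinarith
    rcases hθ1.eq_or_lt with rfl | hθ1
    · simpa using hyK'
    have hgap : 0 < a + b - ε := by nlinarith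
    have h := hK'.add_smul_sub_add_smul_sub_mem hyK' hp₁ hp₂
      (s := (1 - θ) / (a + b - ε) * a) (t := (1 - θ) / (a + b - ε) * b)
      (mul_nonneg (div_nonneg (by linarith) hgap.le) ha0)
      (mul_nonneg (div_nonneg (by linarith) hgap.le) hb0)
      (by rw [← mul_add, div_mul_eq_mul_div, div_le_one hgap]; linarith)
    have hτ : (1 - θ) / (a + b - ε) * (a + b - ε) = 1 - θ := div_mul_cancel₀ _ hgap.ne'
    convert h using 1
    generalize (1 - θ) / (a + b - ε) = τ at hτ
    have hy' : y = v + (a • e₁ + b • e₂) := by rw [← hye]; abel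
    have hθτ : θ = 1 - τ * (a + b - ε) := by linarith
    rw [hθτ, hy']
    module
  rw [← hTvol, ← measure_union hdisj hTm]
  congr 1
  exact Set.Subset.antisymm (Set.union_subset hK'K hTK) hcover
end
end
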